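/- Let u ∈ L^∞(ℝ^d), b ∈ W^{1,1}_loc(ℝ^d; ℝ^d) with div b ∈ L^1_loc(ℝ^d), and let θ be a smooth even nonnegative convolution kernel supported in the unit ball with θ_ε(x)=ε^{-d}θ(x/ε). Define the commutator r_ε = b·∇(u*θ_ε) − (b·∇u)*θ_ε (where b·∇u is interpreted in the distributional sense as div(ub) − u div b). Then for every compact set Q ⊂ ℝ^d, r_ε → 0 in L^1(Q) as ε → 0. -/

import Mathlib

open Real MeasureTheory Metric Filter
open scoped RealInnerProductSpace Topology

section general
open scoped ENNReal NNReal

variable {E : Type*} [NormedAddCommGroup E] [InnerProductSpace ℝ E] [FiniteDimensional ℝ E]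
  [MeasurableSpace E] [BorelSpace E]

/-- continuity of translations in `L^1_loc`. -/
lemma tr_cont {f : E → ℝ} (hf : LocallyIntegrable f volume) (hfm : Measurable f)
    {Q : Set E} (hQ : IsCompact Q) (η : ℝ≥0∞) (hη : η ≠ 0) :
    ∀ᶠ h in 𝓝 (0:E), ∫⁻ x in Q, ‖f (x - h) - f x‖ₑ ≤ η := by
  -- the cutoff
  obtain ⟨R, hR⟩ := hQ.isBounded.subset_closedBall (0:E)
  set K : Set E := closedBall (0:E) (R + 1) with hK
  have hKc : IsCompact K := isCompact_closedBall _ _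
  set f' : E → ℝ := K.indicator f with hf'
  have hf'i : Integrable f' volume :=
    (integrable_indicator_iff hKc.measurableSet).2 (hf.integrableOn_isCompact hKc)
  have hη3 : η / 3 ≠ 0 := by simp [hη]
  obtain ⟨g, hgs, hgle, hgc, hgi⟩ := hf'i.exists_hasCompactSupport_lintegral_sub_le hη3
  have hf'm : Measurable f' := hfm.indicator hKc.measurableSet
  have hgm : Measurable g := hgc.measurable
  have hguc : UniformContinuous g := hgs.uniformContinuous_of_continuous hgc
  have hQf : volume Q ≠ ∞ := hQ.measure_lt_top.ne
  have hx : ∃ c : ℝ≥0, 0 < c ∧ c * volume Q ≤ η / 3 := by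
    obtain ⟨c, hc0, hc⟩ := ENNReal.exists_nnreal_pos_mul_lt hQf hη3
    exact ⟨c, hc0, hc.le⟩
  obtain ⟨c, hc0, hc⟩ := hx
  obtain ⟨δ, hδ, hgδ⟩ := Metric.uniformContinuous_iff.1 hguc c hc0
  have hmin : 0 < min δ 1 := lt_min hδ one_pos
  filter_upwards [Metric.ball_mem_nhds (0:E) hmin] with h hh
  have hhn : ‖h‖ < min δ 1 := by simpa using hh
  have hh1 : ‖h‖ < 1 := hhn.trans_le (min_le_right _ _)
  have hhδ : ‖h‖ < δ := hhn.trans_le (min_le_left _ _)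
  have key : ∀ x ∈ Q, ‖f (x - h) - f x‖ₑ ≤
      ‖f' (x - h) - g (x - h)‖ₑ + c + ‖f' x - g x‖ₑ := by
    intro x hxQ
    have hxR : ‖x‖ ≤ R := by simpa using hR hxQ
    have h1 : x ∈ K := by simp [hK]; linarith
    have h2 : x - h ∈ K := by
      have := norm_sub_le x h
      simp [hK]; linarith
    have e1 : f' x = f x := Set.indicator_of_mem h1 _
    have e2 : f' (x - h) = f (x - h) := Set.indicator_of_mem h2 _
    have e3 : ‖g (x - h) - g x‖ₑ ≤ c := by
      have : dist (g (x - h)) (g x) < c := hgδ (by simpa [dist_eq_norm] using hhδ)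
      rw [dist_eq_norm] at this
      rw [← ofReal_norm]
      exact ENNReal.ofReal_le_of_le_toReal (by simpa using this.le)
    rw [← e1, ← e2]
    calc ‖f' (x - h) - f' x‖ₑ = ‖(f' (x - h) - g (x - h)) + (g (x - h) - g x) + -(f' x - g x)‖ₑ := by
          congr 1; ring
      _ ≤ ‖(f' (x - h) - g (x - h)) + (g (x - h) - g x)‖ₑ + ‖-(f' x - g x)‖ₑ := enorm_add_le _ _
      _ ≤ ‖(f' (x - h) - g (x - h))‖ₑ + ‖(g (x - h) - g x)‖ₑ + ‖-(f' x - g x)‖ₑ := by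
          gcongr; exact enorm_add_le _ _
      _ ≤ _ := by rw [enorm_neg]; gcongr
  calc ∫⁻ x in Q, ‖f (x - h) - f x‖ₑ
      ≤ ∫⁻ x in Q, (‖f' (x - h) - g (x - h)‖ₑ + c + ‖f' x - g x‖ₑ) :=
        setLIntegral_mono' hQ.measurableSet key
    _ = (∫⁻ x in Q, ‖f' (x - h) - g (x - h)‖ₑ) + c * volume Q + ∫⁻ x in Q, ‖f' x - g x‖ₑ := by
        rw [lintegral_add_right _ (by fun_prop), lintegral_add_right _ (by fun_prop)]
        simp
    _ ≤ (∫⁻ x, ‖f' (x - h) - g (x - h)‖ₑ) + c * volume Q + ∫⁻ x, ‖f' x - g x‖ₑ := by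
        exact add_le_add (add_le_add (setLIntegral_le_lintegral _ _) le_rfl)
          (setLIntegral_le_lintegral _ _)
    _ ≤ η / 3 + η / 3 + η / 3 := by
        rw [lintegral_sub_right_eq_self (fun x => ‖f' x - g x‖ₑ) h]
        gcongr
    _ = η := ENNReal.add_thirds η

lemma tr_cont_bdd {f u : E → ℝ} (hf : LocallyIntegrable f volume) (hfm : Measurable f)
    (hum : Measurable u) {L : ℝ≥0} (hL : ∀ x, ‖u x‖₊ ≤ L)
    {Q : Set E} (hQ : IsCompact Q) (η : ℝ≥0∞) (hη : η ≠ 0) :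
    ∀ᶠ h in 𝓝 (0:E), ∫⁻ x in Q, ‖(u (x - h) - u x) * f x‖ₑ ≤ η := by
  have huf : LocallyIntegrable (fun x => u x * f x) volume := by
    intro x
    obtain ⟨s, hs, hsi⟩ := hf x
    refine ⟨s, hs, ?_⟩
    refine Integrable.bdd_mul (c := L) hsi hum.aestronglyMeasurable (ae_of_all _ fun x => ?_)
    exact_mod_cast hL x
  have hη2 : η / 2 ≠ 0 := by simp [hη]
  obtain ⟨c, hc0, hc⟩ : ∃ c : ℝ≥0, 0 < c ∧ c * (L:ℝ≥0∞) < η / 2 :=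
    ENNReal.exists_nnreal_pos_mul_lt ENNReal.coe_ne_top hη2
  filter_upwards [tr_cont huf (hum.mul hfm) hQ _ hη2,
    tr_cont hf hfm hQ c (by exact_mod_cast hc0.ne')] with h h1 h2
  calc ∫⁻ x in Q, ‖(u (x - h) - u x) * f x‖ₑ
      ≤ ∫⁻ x in Q, (‖u (x - h) * f (x - h) - u x * f x‖ₑ + L * ‖f (x - h) - f x‖ₑ) := by
        apply lintegral_mono
        intro x
        calc ‖(u (x - h) - u x) * f x‖ₑ
            = ‖(u (x - h) * f (x - h) - u x * f x) + -(u (x - h) * (f (x - h) - f x))‖ₑ := by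
              congr 1; ring
          _ ≤ _ := enorm_add_le _ _
          _ ≤ _ := by
              rw [enorm_neg, enorm_mul (u (x - h)) (f (x - h) - f x)]
              exact add_le_add le_rfl (mul_le_mul' (ENNReal.coe_le_coe.2 (hL _)) le_rfl)
    _ = (∫⁻ x in Q, ‖u (x - h) * f (x - h) - u x * f x‖ₑ)
          + L * ∫⁻ x in Q, ‖f (x - h) - f x‖ₑ := by
        rw [lintegral_add_right _ (by fun_prop), lintegral_const_mul _ (by fun_prop)]
    _ ≤ η / 2 + L * c := by gcongr
    _ ≤ η / 2 + η / 2 := by gcongr; rw [mul_comm]; exact hc.le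
    _ = η := ENNReal.add_halves η

lemma locInt_tr {f : E → ℝ} (hf : LocallyIntegrable f volume) (h : E) :
    LocallyIntegrable (fun x => f (x - h)) volume := by
  rw [locallyIntegrable_iff]
  intro K hK
  have hK' : IsCompact ((fun x => x - h) '' K) := hK.image (by fun_prop)
  have h1 : Integrable (((fun x => x - h) '' K).indicator f) volume :=
    (integrable_indicator_iff hK'.measurableSet).2 (hf.integrableOn_isCompact hK')
  refine (h1.comp_sub_right h).integrableOn.congr_fun ?_ hK.measurableSet
  intro x hx
  exact Set.indicator_of_mem (Set.mem_image_of_mem _ hx) _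

lemma int_prod {G : E → ℝ} (hG : LocallyIntegrable G volume) (hGm : Measurable G)
    {K : Set E} (hK : IsCompact K) (h : E) :
    Integrable (fun p : E × ℝ => G (p.1 - p.2 • h))
      ((volume.restrict K).prod (volume.restrict (Set.Icc (0:ℝ) 1))) := by
  set K' : Set E := (fun p : E × ℝ => p.1 - p.2 • h) '' (K ×ˢ Set.Icc (0:ℝ) 1) with hK'
  have hK'c : IsCompact K' := (hK.prod isCompact_Icc).image (by fun_prop)
  have h1 : Integrable (K'.indicator G) volume :=
    (integrable_indicator_iff hK'c.measurableSet).2 (hG.integrableOn_isCompact hK'c)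
  have hm : Measurable (fun p : E × ℝ => G (p.1 - p.2 • h)) := hGm.comp (by fun_prop)
  refine ⟨hm.aestronglyMeasurable, ?_⟩
  rw [hasFiniteIntegral_iff_enorm, lintegral_prod_symm' _ hm.enorm]
  calc ∫⁻ t in Set.Icc (0:ℝ) 1, ∫⁻ x in K, ‖G (x - t • h)‖ₑ
      ≤ ∫⁻ t in Set.Icc (0:ℝ) 1, ∫⁻ x, ‖K'.indicator G x‖ₑ := by
        refine setLIntegral_mono' measurableSet_Icc fun t ht => ?_
        calc ∫⁻ x in K, ‖G (x - t • h)‖ₑ ≤ ∫⁻ x in K, ‖K'.indicator G (x - t • h)‖ₑ := by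
              refine setLIntegral_mono' hK.measurableSet fun x hx => ?_
              rw [Set.indicator_of_mem]
              exact ⟨(x, t), ⟨hx, ht⟩, rfl⟩
          _ ≤ ∫⁻ x, ‖K'.indicator G (x - t • h)‖ₑ := setLIntegral_le_lintegral _ _
          _ = _ := lintegral_sub_right_eq_self (fun x => ‖K'.indicator G x‖ₑ) (t • h)
    _ = ∫⁻ x, ‖K'.indicator G x‖ₑ := by simp
    _ < ∞ := h1.2

lemma weak_ftc {f G : E → ℝ} (hf : LocallyIntegrable f volume) (hfm : Measurable f)
    (hG : LocallyIntegrable G volume) (hGm : Measurable G) (h : E)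
    (hw : ∀ ψ : E → ℝ, ContDiff ℝ (⊤ : ℕ∞) ψ → HasCompactSupport ψ →
      ∫ x, G x * ψ x = -∫ x, f x * fderiv ℝ ψ x h) :
    ∀ᵐ x, f x - f (x - h) = ∫ t in Set.Icc (0:ℝ) 1, G (x - t • h) := by
  refine ae_eq_of_integral_contDiff_smul_eq (hf.sub (locInt_tr hf h)) ?_ ?_
  · rw [locallyIntegrable_iff]
    intro K hK
    exact (int_prod hG hGm hK h).integral_prod_left
  intro ψ hψ hψc
  simp only [smul_eq_mul]
  have hψcont : Continuous ψ := hψ.continuous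
  have hψ1 : ContDiff ℝ 1 ψ := hψ.of_le (by exact_mod_cast le_top)
  have hψd : Continuous (fun x => fderiv ℝ ψ x h) :=
    (hψ1.continuous_fderiv one_ne_zero).clm_apply continuous_const
  have hψdc : HasCompactSupport (fun x => fderiv ℝ ψ x h) := hψc.fderiv_apply (𝕜 := ℝ) h
  obtain ⟨C, hC⟩ := hψc.exists_bound_of_continuous hψcont
  obtain ⟨C', hC'⟩ := hψdc.exists_bound_of_continuous hψd
  set K := tsupport ψ with hKdef
  have hK : IsCompact K := hψc
  have hψK : ∀ x, x ∉ K → ψ x = 0 := fun x hx => image_eq_zero_of_notMem_tsupport hx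
  have hdψK : ∀ x, x ∉ K → fderiv ℝ ψ x h = 0 := fun x hx => by
    have := (tsupport_fderiv_subset ℝ (f := ψ))
    rw [image_eq_zero_of_notMem_tsupport (f := fderiv ℝ ψ) (fun h => hx (this h))]; rfl
  -- second set
  set K2 : Set E := (fun p : E × ℝ => p.1 - p.2 • h) '' (K ×ˢ Set.Icc (0:ℝ) 1) with hK2
  have hK2c : IsCompact K2 := (hK.prod isCompact_Icc).image (by fun_prop)
  have hK2mem : ∀ x, x ∉ K2 → ∀ t ∈ Set.Icc (0:ℝ) 1, x + t • h ∉ K := by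
    intro x hx t ht hxt
    exact hx ⟨(x + t • h, t), ⟨hxt, ht⟩, by simp⟩
  -- right-hand side
  have R1 : ∫ x, ψ x * ∫ t in Set.Icc (0:ℝ) 1, G (x - t • h)
      = ∫ t in Set.Icc (0:ℝ) 1, ∫ x, ψ x * G (x - t • h) := by
    have e1 : ∫ x, ψ x * ∫ t in Set.Icc (0:ℝ) 1, G (x - t • h)
        = ∫ x in K, ∫ t in Set.Icc (0:ℝ) 1, ψ x * G (x - t • h) := by
      rw [← setIntegral_eq_integral_of_forall_compl_eq_zero (s := K)
        (fun x hx => by rw [hψK x hx, zero_mul])]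
      refine integral_congr_ae (ae_of_all _ fun x => ?_)
      exact (integral_const_mul _ _).symm
    have e2 : ∀ t : ℝ, ∫ x, ψ x * G (x - t • h) = ∫ x in K, ψ x * G (x - t • h) := fun t =>
      (setIntegral_eq_integral_of_forall_compl_eq_zero (s := K)
        (fun x hx => by rw [hψK x hx, zero_mul])).symm
    simp_rw [e1, e2]
    refine integral_integral_swap ?_
    exact (int_prod hG hGm hK h).bdd_mul (c := C)
      (hψcont.comp continuous_fst).aestronglyMeasurable (ae_of_all _ fun p => hC p.1)
  have R2 : ∀ t : ℝ, ∫ x, ψ x * G (x - t • h) = - ∫ x, f x * fderiv ℝ ψ (x + t • h) h := by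
    intro t
    have e1 : ∫ x, ψ x * G (x - t • h) = ∫ x, G x * ψ (x + t • h) := by
      rw [← integral_add_right_eq_self (fun x => ψ x * G (x - t • h)) (t • h)]
      simp [mul_comm]
    rw [e1]
    have := hw (fun x => ψ (x + t • h)) (hψ.comp (by fun_prop))
      (hψc.comp_homeomorph (Homeomorph.addRight (t • h)))
    rw [this]
    simp_rw [fderiv_comp_add_right]
  have R3 : ∫ t in Set.Icc (0:ℝ) 1, ∫ x, f x * fderiv ℝ ψ (x + t • h) h
      = ∫ x, f x * (ψ (x + h) - ψ x) := by
    have e1 : ∫ t in Set.Icc (0:ℝ) 1, ∫ x, f x * fderiv ℝ ψ (x + t • h) h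
      = ∫ t in Set.Icc (0:ℝ) 1, ∫ x in K2, f x * fderiv ℝ ψ (x + t • h) h := by
      refine setIntegral_congr_fun measurableSet_Icc fun t ht => ?_
      exact (setIntegral_eq_integral_of_forall_compl_eq_zero (s := K2)
        (fun x hx => by rw [hdψK _ (hK2mem x hx t ht), mul_zero])).symm
    have e2 : ∀ x, ∫ t in Set.Icc (0:ℝ) 1, f x * fderiv ℝ ψ (x + t • h) h
        = f x * (ψ (x + h) - ψ x) := by
      intro x
      rw [integral_const_mul]
      congr 1
      rw [integral_Icc_eq_integral_Ioc, ← intervalIntegral.integral_of_le zero_le_one]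
      have hd : ∀ t ∈ Set.uIcc (0:ℝ) 1,
          HasDerivAt (fun t : ℝ => ψ (x + t • h)) (fderiv ℝ ψ (x + t • h) h) t := by
        intro t _
        have h1 : HasFDerivAt ψ (fderiv ℝ ψ (x + t • h)) (x + t • h) :=
          (hψ1.differentiable one_ne_zero _).hasFDerivAt
        have h2 : HasDerivAt (fun t : ℝ => x + t • h) h t := by
          simpa using ((hasDerivAt_id t).smul_const h).const_add x
        exact h1.comp_hasDerivAt t h2
      rw [intervalIntegral.integral_eq_sub_of_hasDerivAt hd]
      · simp
      · exact (hψd.comp (by fun_prop : Continuous fun t : ℝ => x + t • h)).intervalIntegrable _ _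
    rw [e1, ← integral_integral_swap]
    · simp_rw [e2]
      refine setIntegral_eq_integral_of_forall_compl_eq_zero (fun x hx => ?_)
      have a1 := hψK _ (hK2mem x hx 1 (by simp))
      have a0 := hψK _ (hK2mem x hx 0 (by simp))
      simp only [one_smul, zero_smul, add_zero] at a1 a0
      simp [a1, a0]
    · have hi : Integrable (fun p : E × ℝ => f p.1)
          ((volume.restrict K2).prod (volume.restrict (Set.Icc (0:ℝ) 1))) :=
        Integrable.comp_fst (hf.integrableOn_isCompact hK2c) _
      refine hi.mul_bdd (c := C')
        (hψd.comp (by fun_prop : Continuous fun p : E × ℝ => p.1 + p.2 • h)).aestronglyMeasurable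
        (ae_of_all _ fun p => hC' _)
  rw [R1]
  simp_rw [R2]
  rw [integral_neg, R3]
  have i1 : Integrable (fun x => f x * ψ x) volume := by
    simpa [mul_comm] using hf.integrable_smul_left_of_hasCompactSupport hψcont hψc
  have i2 : Integrable (fun x => f x * ψ (x + h)) volume := by
    simpa [mul_comm] using hf.integrable_smul_left_of_hasCompactSupport
      (hψcont.comp (by fun_prop : Continuous fun x => x + h))
      (hψc.comp_homeomorph (Homeomorph.addRight h))
  have i3 : Integrable (fun x => f (x - h) * ψ x) volume := by
    simpa using i2.comp_sub_right h
  have e3 : ∫ x, f (x - h) * ψ x = ∫ x, f x * ψ (x + h) := by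
    rw [← integral_sub_right_eq_self (fun x => f x * ψ (x + h)) h]
    simp
  calc ∫ x, ψ x * (f x - f (x - h)) = ∫ x, (f x * ψ x - f (x - h) * ψ x) := by
        congr 1; ext x; ring
    _ = (∫ x, f x * ψ x) - ∫ x, f x * ψ (x + h) := by rw [integral_sub i1 i3, e3]
    _ = -∫ x, (f x * ψ (x + h) - f x * ψ x) := by rw [integral_sub i2 i1]; ring
    _ = _ := by simp_rw [mul_sub]

lemma weak_diff {f G : E → ℝ} (hf : LocallyIntegrable f volume) (hfm : Measurable f)
    (hG : LocallyIntegrable G volume) (hGm : Measurable G) (h : E)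
    (hw : ∀ ψ : E → ℝ, ContDiff ℝ (⊤ : ℕ∞) ψ → HasCompactSupport ψ →
      ∫ x, G x * ψ x = -∫ x, f x * fderiv ℝ ψ x h) {Q : Set E} (hQ : IsCompact Q) :
    ∫⁻ x in Q, ‖f x - f (x - h) - G x‖ₑ ≤
      ∫⁻ t in Set.Icc (0:ℝ) 1, ∫⁻ x in Q, ‖G (x - t • h) - G x‖ₑ := by
  have hm : Measurable (fun p : E × ℝ => G (p.1 - p.2 • h)) := hGm.comp (by fun_prop)
  have hm' : Measurable (fun p : E × ℝ => G p.1) := hGm.comp (by fun_prop)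
  have hsl := (int_prod hG hGm hQ h).prod_right_ae
  rw [← lintegral_lintegral_swap (by exact (hm.sub hm').enorm.aemeasurable)]
  refine lintegral_mono_ae ?_
  filter_upwards [ae_restrict_of_ae (weak_ftc hf hfm hG hGm h hw), hsl] with x hx hxi
  have : f x - f (x - h) - G x = ∫ t in Set.Icc (0:ℝ) 1, (G (x - t • h) - G x) := by
    rw [integral_sub hxi (integrable_const _), ← hx]; simp
  rw [this]
  exact enorm_integral_le_lintegral_enorm _

lemma ev_scale {p : E → Prop} (hp : ∀ᶠ h in 𝓝 (0:E), p h) :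
    ∀ᶠ ε in 𝓝[>] (0:ℝ), ∀ z : E, ‖z‖ ≤ 1 → p (ε • z) := by
  obtain ⟨δ, hδ, hb⟩ := Metric.eventually_nhds_iff.1 hp
  filter_upwards [Ioo_mem_nhdsGT hδ] with ε hε z hz
  apply hb
  rw [dist_zero_right, norm_smul, Real.norm_of_nonneg hε.1.le]
  nlinarith [hε.1, hε.2, norm_nonneg z]

lemma int_I {f u φ : E → ℝ} (hf : LocallyIntegrable f volume)
    (hum : Measurable u) {L : ℝ≥0} (hL : ∀ x, ‖u x‖₊ ≤ L) (hφ : Continuous φ)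
    (hφc : HasCompactSupport φ) (x : E) {ε : ℝ} (hε : 0 < ε) :
    Integrable (fun z => u (x - ε • z) * (f (x - ε • z) * φ z)) volume := by
  have h1 : Integrable (fun y => f y * φ (ε⁻¹ • (x - y))) volume := by
    have hc : Continuous (fun y => φ (ε⁻¹ • (x - y))) := hφ.comp (by fun_prop)
    have hs : HasCompactSupport (fun y => φ (ε⁻¹ • (x - y))) :=
      hφc.comp_homeomorph ((Homeomorph.subLeft x).trans
        (Homeomorph.smulOfNeZero ε⁻¹ (inv_ne_zero hε.ne')))
    simpa [mul_comm] using hf.integrable_smul_left_of_hasCompactSupport hc hs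
  have h2 : Integrable (fun y => u y * (f y * φ (ε⁻¹ • (x - y)))) volume :=
    h1.bdd_mul (c := L) hum.aestronglyMeasurable (ae_of_all _ fun x => by exact_mod_cast hL x)
  have h3 := (h2.comp_sub_left x).comp_smul hε.ne'
  refine h3.congr (ae_of_all _ fun z => ?_)
  simp [smul_smul, hε.ne']

end general

section main
open scoped ENNReal NNReal

lemma fderiv_sum_basis {d : ℕ} (ψ : EuclideanSpace ℝ (Fin d) → ℝ) (x h : EuclideanSpace ℝ (Fin d)) :
    fderiv ℝ ψ x h = ∑ j, h j * fderiv ℝ ψ x (EuclideanSpace.single j 1) := by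
  conv_lhs => rw [← (EuclideanSpace.basisFun (Fin d) ℝ).sum_repr h]
  simp [map_sum]

lemma W_small {d : ℕ} {f : EuclideanSpace ℝ (Fin d) → ℝ} {g : Fin d → EuclideanSpace ℝ (Fin d) → ℝ}
    (hf : LocallyIntegrable f volume) (hfm : Measurable f)
    (hg : ∀ j, LocallyIntegrable (g j) volume) (hgm : ∀ j, Measurable (g j))
    (hw : ∀ ψ : EuclideanSpace ℝ (Fin d) → ℝ, ContDiff ℝ (⊤ : ℕ∞) ψ → HasCompactSupport ψ →
      ∀ j, ∫ x, g j x * ψ x = -∫ x, f x * fderiv ℝ ψ x (EuclideanSpace.single j 1))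
    {Q : Set (EuclideanSpace ℝ (Fin d))} (hQ : IsCompact Q) (η : ℝ≥0∞) (hη : η ≠ 0) :
    ∀ᶠ h in 𝓝 (0 : EuclideanSpace ℝ (Fin d)),
      ∫⁻ x in Q, ‖f x - f (x - h) - ∑ j, g j x * h j‖ₑ ≤ η * ‖h‖ₑ := by
  obtain ⟨c, hc0, hc⟩ := ENNReal.exists_nnreal_pos_mul_lt (ENNReal.natCast_ne_top d) hη
  have hev : ∀ᶠ h in 𝓝 (0 : EuclideanSpace ℝ (Fin d)), ∀ j,
      ∫⁻ x in Q, ‖g j (x - h) - g j x‖ₑ ≤ c :=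
    eventually_all.2 fun j => tr_cont (hg j) (hgm j) hQ c (by exact_mod_cast hc0.ne')
  obtain ⟨δ, hδ, hb⟩ := Metric.eventually_nhds_iff.1 hev
  filter_upwards [Metric.ball_mem_nhds _ hδ] with h hh
  have hG : LocallyIntegrable (fun x => ∑ j, g j x * h j) volume := by
    have : LocallyIntegrable (fun x => ∑ j, h j • g j x) volume :=
      locallyIntegrable_finsetSum _ fun j _ => (hg j).smul (h j)
    simpa [mul_comm] using this
  have hGm : Measurable (fun x => ∑ j, g j x * h j) :=
    Finset.measurable_sum _ fun j _ => (hgm j).mul_const _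
  refine (weak_diff hf hfm hG hGm h ?_ hQ).trans ?_
  · intro ψ hψ hψc
    have hψ1 : ContDiff ℝ 1 ψ := hψ.of_le (by exact_mod_cast le_top)
    have i1 : ∀ j, Integrable (fun x => g j x * ψ x) volume := fun j => by
      simpa [mul_comm] using (hg j).integrable_smul_left_of_hasCompactSupport hψ.continuous hψc
    have i2 : ∀ j, Integrable (fun x => f x * fderiv ℝ ψ x (EuclideanSpace.single j 1)) volume :=
      fun j => by
      simpa [mul_comm] using hf.integrable_smul_left_of_hasCompactSupport
        ((hψ1.continuous_fderiv one_ne_zero).clm_apply continuous_const)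
        (hψc.fderiv_apply (𝕜 := ℝ) (EuclideanSpace.single j 1))
    calc ∫ x, (∑ j, g j x * h j) * ψ x = ∫ x, ∑ j, h j * (g j x * ψ x) := by
          congr 1; ext x; rw [Finset.sum_mul]; exact Finset.sum_congr rfl fun j _ => by ring
      _ = ∑ j, h j * ∫ x, g j x * ψ x := by
          rw [integral_finsetSum _ fun j _ => (i1 j).const_mul _]
          simp_rw [integral_const_mul]
      _ = - ∑ j, h j * ∫ x, f x * fderiv ℝ ψ x (EuclideanSpace.single j 1) := by
          rw [← Finset.sum_neg_distrib]
          exact Finset.sum_congr rfl fun j _ => by rw [hw ψ hψ hψc j]; ring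
      _ = - ∫ x, ∑ j, h j * (f x * fderiv ℝ ψ x (EuclideanSpace.single j 1)) := by
          rw [integral_finsetSum _ fun j _ => (i2 j).const_mul _]
          simp_rw [integral_const_mul]
      _ = _ := by
          congr 2; ext x
          rw [fderiv_sum_basis ψ x h, Finset.mul_sum]
          exact Finset.sum_congr rfl fun j _ => by ring
  · have hn : ∀ j, ‖h j‖ₑ ≤ ‖h‖ₑ := fun j => by
      rw [enorm_le_iff_norm_le]; exact PiLp.norm_apply_le h j
    calc ∫⁻ t in Set.Icc (0:ℝ) 1, ∫⁻ x in Q, ‖∑ j, g j (x - t • h) * h j - ∑ j, g j x * h j‖ₑ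
        ≤ ∫⁻ t in Set.Icc (0:ℝ) 1, η * ‖h‖ₑ := by
          refine setLIntegral_mono' measurableSet_Icc fun t ht => ?_
          have hth : dist (t • h) 0 < δ := by
            have : ‖h‖ < δ := by simpa using hh
            rw [dist_zero_right, norm_smul, Real.norm_of_nonneg ht.1]
            nlinarith [ht.1, ht.2, norm_nonneg h]
          calc ∫⁻ x in Q, ‖∑ j, g j (x - t • h) * h j - ∑ j, g j x * h j‖ₑ
              ≤ ∫⁻ x in Q, ∑ j, ‖g j (x - t • h) - g j x‖ₑ * ‖h‖ₑ := by
                refine lintegral_mono fun x => ?_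
                rw [← Finset.sum_sub_distrib]
                refine (enorm_sum_le _ _).trans (Finset.sum_le_sum fun j _ => ?_)
                rw [← sub_mul, enorm_mul]
                exact mul_le_mul' le_rfl (hn j)
            _ = ∑ j, (∫⁻ x in Q, ‖g j (x - t • h) - g j x‖ₑ) * ‖h‖ₑ := by
                have hmj : ∀ j, Measurable (fun x => ‖g j (x - t • h) - g j x‖ₑ) := fun j => by
                  have := hgm j
                  fun_prop
                rw [lintegral_finsetSum _ fun j _ => (hmj j).mul_const _]
                simp_rw [lintegral_mul_const _ (hmj _)]
            _ ≤ ∑ j : Fin d, c * ‖h‖ₑ :=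
                Finset.sum_le_sum fun j _ => mul_le_mul' (hb hth j) le_rfl
            _ = (c * d) * ‖h‖ₑ := by simp; ring
            _ ≤ η * ‖h‖ₑ := mul_le_mul' hc.le le_rfl
      _ = η * ‖h‖ₑ := by simp

lemma theta_moment {d : ℕ} {θ : EuclideanSpace ℝ (Fin d) → ℝ} (hθ : ContDiff ℝ 1 θ)
    (hc : HasCompactSupport θ) (hθ_int : ∫ x, θ x = 1) (i j : Fin d) :
    ∫ z, z j * fderiv ℝ θ z (EuclideanSpace.single i 1) = if i = j then -1 else 0 := by
  have hd : ∀ x : EuclideanSpace ℝ (Fin d), HasFDerivAt (fun z : EuclideanSpace ℝ (Fin d) => z j)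
      (EuclideanSpace.proj j : EuclideanSpace ℝ (Fin d) →L[ℝ] ℝ) x := fun x =>
    (EuclideanSpace.proj j : EuclideanSpace ℝ (Fin d) →L[ℝ] ℝ).hasFDerivAt
  have hcd := (hθ.continuous_fderiv one_ne_zero).clm_apply
    (continuous_const (y := EuclideanSpace.single i (1:ℝ)))
  rw [integral_mul_fderiv_eq_neg_fderiv_mul_of_integrable]
  · simp_rw [(hd _).fderiv]
    simp only [PiLp.proj_apply, integral_const_mul, hθ_int]
    simp [eq_comm, Pi.single_apply]
    split_ifs <;> simp
  · simp_rw [(hd _).fderiv]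
    exact (hθ.continuous.integrable_of_hasCompactSupport hc).const_mul _
  · exact Continuous.integrable_of_hasCompactSupport (by fun_prop)
      (hc.fderiv_apply (𝕜 := ℝ) _).mul_left
  · exact Continuous.integrable_of_hasCompactSupport
      (by have := hθ.continuous; fun_prop) hc.mul_left
  · exact fun x _ => (hd x).differentiableAt
  · exact fun x _ => hθ.differentiable one_ne_zero x

lemma main_aux {d : ℕ} {u : EuclideanSpace ℝ (Fin d) → ℝ}
    {b : Fin d → EuclideanSpace ℝ (Fin d) → ℝ} {g : Fin d → Fin d → EuclideanSpace ℝ (Fin d) → ℝ}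
    {dv : EuclideanSpace ℝ (Fin d) → ℝ} (hum : Measurable u) {L : ℝ≥0} (hL : ∀ x, ‖u x‖₊ ≤ L)
    (hb : ∀ i, LocallyIntegrable (b i) volume) (hbm : ∀ i, Measurable (b i))
    (hg : ∀ i j, LocallyIntegrable (g i j) volume) (hgm : ∀ i j, Measurable (g i j))
    (hdv : LocallyIntegrable dv volume) (hdvm : Measurable dv)
    (hw : ∀ ψ : EuclideanSpace ℝ (Fin d) → ℝ, ContDiff ℝ (⊤ : ℕ∞) ψ → HasCompactSupport ψ →
      ∀ i j, ∫ x, g i j x * ψ x = -∫ x, b i x * fderiv ℝ ψ x (EuclideanSpace.single j 1))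
    (htr : ∀ᵐ x, dv x = ∑ i, g i i x)
    {θ : EuclideanSpace ℝ (Fin d) → ℝ} {φ : Fin d → EuclideanSpace ℝ (Fin d) → ℝ}
    (hθ : Continuous θ) (hθs : tsupport θ ⊆ closedBall 0 1) (hθi : ∫ z, θ z = 1)
    (hφ : ∀ i, Continuous (φ i)) (hφs : ∀ i, tsupport (φ i) ⊆ closedBall 0 1)
    (hφi : ∀ i j, ∫ z : EuclideanSpace ℝ (Fin d), z j * φ i z = if i = j then -1 else 0)
    {Q : Set (EuclideanSpace ℝ (Fin d))} (hQ : IsCompact Q) (η : ℝ≥0∞) (hη : η ≠ 0) :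
    ∀ᶠ ε in 𝓝[>] (0:ℝ), ∫⁻ x in Q, ‖∫ z, u (x - ε • z) *
      (∑ i, ε⁻¹ * (b i x - b i (x - ε • z)) * φ i z + dv (x - ε • z) * θ z)‖ₑ ≤ η := by
  have hθc : HasCompactSupport θ :=
    (isCompact_closedBall _ _).of_isClosed_subset (isClosed_tsupport _) hθs
  have hφc : ∀ i, HasCompactSupport (φ i) := fun i =>
    (isCompact_closedBall _ _).of_isClosed_subset (isClosed_tsupport _) (hφs i)
  -- bounds
  obtain ⟨C, hCθ, hCφ⟩ : ∃ C : ℝ≥0, (∀ z, ‖θ z‖ₑ ≤ C) ∧ ∀ i z, ‖φ i z‖ₑ ≤ C := by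
    obtain ⟨C1, hC1⟩ := hθc.exists_bound_of_continuous hθ
    choose C2 hC2 using fun i => (hφc i).exists_bound_of_continuous (hφ i)
    refine ⟨Real.toNNReal C1 + ∑ i, Real.toNNReal (C2 i), fun z => ?_, fun i z => ?_⟩
    · refine ENNReal.coe_le_coe.2 (le_trans ?_ le_self_add)
      exact NNReal.coe_le_coe.1 ((hC1 z).trans (Real.le_coe_toNNReal _))
    · refine ENNReal.coe_le_coe.2 (le_trans (le_trans ?_
        (Finset.single_le_sum (f := fun i => Real.toNNReal (C2 i)) (fun _ _ => zero_le)
          (Finset.mem_univ i))) le_add_self)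
      exact NNReal.coe_le_coe.1 ((hC2 i z).trans (Real.le_coe_toNNReal _))
  set B : Set (EuclideanSpace ℝ (Fin d)) := closedBall 0 1 with hB
  have hBf : volume B ≠ ∞ := (isCompact_closedBall _ _).measure_lt_top.ne
  set A : ℝ≥0∞ := (L * C * (d + 1) + C * (d * d + 1)) * volume B with hA
  have hAf : A ≠ ∞ := by
    refine ENNReal.mul_ne_top (ENNReal.add_ne_top.2 ⟨?_, ?_⟩) hBf
    · exact_mod_cast ENNReal.coe_ne_top (r := L * C * (d + 1))
    · exact_mod_cast ENNReal.coe_ne_top (r := C * (d * d + 1))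
  obtain ⟨c, hc0, hc⟩ := ENNReal.exists_nnreal_pos_mul_lt hAf hη
  have hc0' : (c : ℝ≥0∞) ≠ 0 := by exact_mod_cast hc0.ne'
  have E1 := ev_scale (eventually_all.2 fun i => W_small (hb i) (hbm i) (hg i) (hgm i)
    (fun ψ h1 h2 j => hw ψ h1 h2 i j) hQ c hc0')
  have E2 := ev_scale (tr_cont hdv hdvm hQ c hc0')
  have E3 := ev_scale (eventually_all.2 fun i => eventually_all.2 fun j =>
    tr_cont_bdd (hg i j) (hgm i j) hum hL hQ c hc0')
  have E4 := ev_scale (tr_cont_bdd hdv hdvm hum hL hQ c hc0')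
  filter_upwards [E1, E2, E3, E4, self_mem_nhdsWithin] with ε E1 E2 E3 E4 hε
  have hε : 0 < ε := hε
  -- the frozen-coefficient kernel
  set P : EuclideanSpace ℝ (Fin d) → EuclideanSpace ℝ (Fin d) → ℝ := fun x z =>
    ∑ i, (∑ j, g i j x * z j) * φ i z + dv x * θ z with hP
  set I : EuclideanSpace ℝ (Fin d) → EuclideanSpace ℝ (Fin d) → ℝ := fun x z =>
    u (x - ε • z) *
      (∑ i, ε⁻¹ * (b i x - b i (x - ε • z)) * φ i z + dv (x - ε • z) * θ z) with hI
  set W : Fin d → EuclideanSpace ℝ (Fin d) → EuclideanSpace ℝ (Fin d) → ℝ := fun i x z =>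
    ε⁻¹ * (b i x - b i (x - ε • z) - ∑ j, g i j x * (ε • z) j) with hW
  have hPint : ∀ x, Integrable (P x) volume := by
    intro x
    refine Continuous.integrable_of_hasCompactSupport (by simp only [hP]; fun_prop) ?_
    refine HasCompactSupport.add ?_ hθc.mul_left
    have : ∀ s : Finset (Fin d), HasCompactSupport (fun z : EuclideanSpace ℝ (Fin d) =>
        ∑ i ∈ s, (∑ j, g i j x * z j) * φ i z) := by
      intro s
      induction s using Finset.induction_on with
      | empty => simp only [Finset.sum_empty]; exact HasCompactSupport.zero
      | insert a s ha ih =>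
        simp_rw [Finset.sum_insert ha]
        exact (hφc a).mul_left.add ih
    exact this _
  have hPzero : ∀ᵐ x, ∫ z, P x z = 0 := by
    filter_upwards [htr] with x hx
    have i1 : ∀ i j, Integrable (fun z : EuclideanSpace ℝ (Fin d) => z j * φ i z) volume :=
      fun i j => Continuous.integrable_of_hasCompactSupport (by fun_prop) (hφc i).mul_left
    have i2 : Integrable θ volume := hθ.integrable_of_hasCompactSupport hθc
    have : P x = fun z => ∑ i, ∑ j, g i j x * (z j * φ i z) + dv x * θ z := by
      ext z; simp only [hP]
      congr 1
      refine Finset.sum_congr rfl fun i _ => ?_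
      rw [Finset.sum_mul]
      exact Finset.sum_congr rfl fun j _ => by ring
    rw [this, integral_add (integrable_finsetSum _ fun i _ => integrable_finsetSum _ fun j _ =>
      (i1 i j).const_mul _) (i2.const_mul _), integral_const_mul, hθi,
      integral_finsetSum _ fun i _ => integrable_finsetSum _ fun j _ => (i1 i j).const_mul _]
    simp_rw [integral_finsetSum _ fun j _ => (i1 _ j).const_mul _, integral_const_mul, hφi]
    simp [hx]
  have hIint : ∀ x, Integrable (I x) volume := by
    intro x
    have k1 : ∀ i, Integrable (fun z => u (x - ε • z) * (1 * φ i z)) volume := fun i =>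
      int_I (f := fun _ => (1:ℝ)) (locallyIntegrable_const _) hum hL (hφ i) (hφc i) x hε
    have k2 : ∀ i, Integrable (fun z => u (x - ε • z) * (b i (x - ε • z) * φ i z)) volume :=
      fun i => int_I (hb i) hum hL (hφ i) (hφc i) x hε
    have k3 : Integrable (fun z => u (x - ε • z) * (dv (x - ε • z) * θ z)) volume :=
      int_I hdv hum hL hθ hθc x hε
    have := (integrable_finsetSum Finset.univ fun i _ =>
      (((k1 i).const_mul (b i x)).sub (k2 i)).const_mul ε⁻¹).add k3
    refine this.congr (ae_of_all _ fun z => ?_)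
    simp only [hI, Pi.add_apply, Pi.sub_apply]
    rw [mul_add, Finset.mul_sum]
    congr 1
    exact Finset.sum_congr rfl fun i _ => by ring
  have hdecomp : ∀ x z, I x z - u x * P x z =
      u (x - ε • z) * (∑ i, W i x z * φ i z + (dv (x - ε • z) - dv x) * θ z)
      + (∑ i, ∑ j, ((u (x - ε • z) - u x) * g i j x) * (z j * φ i z)
        + ((u (x - ε • z) - u x) * dv x) * θ z) := by
    intro x z
    have e1 : ∑ i, W i x z * φ i z = ∑ i, ε⁻¹ * (b i x - b i (x - ε • z)) * φ i z
        - ∑ i, (∑ j, g i j x * z j) * φ i z := by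
      rw [← Finset.sum_sub_distrib]
      refine Finset.sum_congr rfl fun i _ => ?_
      have : ∑ j, g i j x * (ε • z) j = ε * ∑ j, g i j x * z j := by
        rw [Finset.mul_sum]
        exact Finset.sum_congr rfl fun j _ => by simp; ring
      simp only [hW, this]
      field_simp
    have e2 : ∑ i, ∑ j, ((u (x - ε • z) - u x) * g i j x) * (z j * φ i z)
        = (u (x - ε • z) - u x) * ∑ i, (∑ j, g i j x * z j) * φ i z := by
      simp_rw [Finset.sum_mul, Finset.mul_sum]
      exact Finset.sum_congr rfl fun i _ => Finset.sum_congr rfl fun j _ => by ring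
    rw [e1, e2]
    simp only [hI, hP]
    ring
  have hbound : ∀ x z, z ∈ B → ‖I x z - u x * P x z‖ₑ ≤
      L * C * (∑ i, ‖W i x z‖ₑ + ‖dv (x - ε • z) - dv x‖ₑ)
      + C * (∑ i, ∑ j, ‖(u (x - ε • z) - u x) * g i j x‖ₑ
        + ‖(u (x - ε • z) - u x) * dv x‖ₑ) := by
    intro x z hz
    have hz1 : ∀ j, ‖z j‖ₑ ≤ 1 := fun j => by
      have h1 : ‖z j‖ ≤ 1 := (PiLp.norm_apply_le z j).trans (by simpa [hB] using hz)
      exact ENNReal.coe_le_coe.2 (show ‖z j‖₊ ≤ 1 from h1)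
    rw [hdecomp]
    refine (enorm_add_le _ _).trans (add_le_add ?_ ?_)
    · rw [enorm_mul, mul_assoc]
      refine mul_le_mul' (ENNReal.coe_le_coe.2 (hL _)) ?_
      refine (enorm_add_le _ _).trans ?_
      rw [mul_add, Finset.mul_sum]
      refine add_le_add ((enorm_sum_le _ _).trans (Finset.sum_le_sum fun i _ => ?_)) ?_
      · rw [enorm_mul, mul_comm]; exact mul_le_mul' (hCφ i z) le_rfl
      · rw [enorm_mul, mul_comm]; exact mul_le_mul' (hCθ z) le_rfl
    · refine (enorm_add_le _ _).trans ?_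
      rw [mul_add, Finset.mul_sum]
      refine add_le_add ((enorm_sum_le _ _).trans (Finset.sum_le_sum fun i _ => ?_)) ?_
      · rw [Finset.mul_sum]
        refine (enorm_sum_le _ _).trans (Finset.sum_le_sum fun j _ => ?_)
        rw [enorm_mul, mul_comm, enorm_mul (z j)]
        refine mul_le_mul' ?_ le_rfl
        calc ‖z j‖ₑ * ‖φ i z‖ₑ ≤ 1 * C := mul_le_mul' (hz1 j) (hCφ i z)
          _ = C := one_mul _
      · rw [enorm_mul, mul_comm]; exact mul_le_mul' (hCθ z) le_rfl
  have hzero : ∀ x z, z ∉ B → ‖I x z - u x * P x z‖ₑ = 0 := by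
    intro x z hz
    have h1 : θ z = 0 := image_eq_zero_of_notMem_tsupport fun h => hz (hθs h)
    have h2 : ∀ i, φ i z = 0 := fun i => image_eq_zero_of_notMem_tsupport fun h => hz (hφs i h)
    simp [hI, hP, h1, h2]
  have hWm : ∀ i z, Measurable (fun x => W i x z) := fun i z => by
    have := hbm i
    have := hgm i
    simp only [hW]; fun_prop
  have hWb : ∀ i z, z ∈ B → ∫⁻ x in Q, ‖W i x z‖ₑ ≤ c := by
    intro i z hz
    have hz' : ‖z‖ ≤ 1 := by simpa [hB] using hz
    have hz1 : ‖z‖ₑ ≤ 1 := by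
      exact ENNReal.coe_le_coe.2 (show ‖z‖₊ ≤ 1 from hz')
    have hm : Measurable (fun x => b i x - b i (x - ε • z) - ∑ j, g i j x * (ε • z) j) := by
      have := hbm i
      have := hgm i
      fun_prop
    simp only [hW, enorm_mul]
    rw [lintegral_const_mul _ hm.enorm]
    calc ‖ε⁻¹‖ₑ * ∫⁻ x in Q, ‖b i x - b i (x - ε • z) - ∑ j, g i j x * (ε • z) j‖ₑ
        ≤ ‖ε⁻¹‖ₑ * (c * ‖ε • z‖ₑ) := mul_le_mul' le_rfl (E1 z hz' i)
      _ = (‖ε⁻¹‖ₑ * ‖ε‖ₑ) * (c * ‖z‖ₑ) := by rw [enorm_smul]; ring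
      _ = c * ‖z‖ₑ := by rw [← enorm_mul, inv_mul_cancel₀ hε.ne']; simp
      _ ≤ c * 1 := mul_le_mul' le_rfl hz1
      _ = c := mul_one _
  have hslice : ∀ z, z ∈ B → ∫⁻ x in Q, ‖I x z - u x * P x z‖ₑ ≤
      c * (L * C * (d + 1) + C * (d * d + 1)) := by
    intro z hz
    have hz' : ‖z‖ ≤ 1 := by simpa [hB] using hz
    have m1 : ∀ i, Measurable (fun x => ‖W i x z‖ₑ) := fun i => (hWm i z).enorm
    have m2 : Measurable (fun x => ‖dv (x - ε • z) - dv x‖ₑ) := by fun_prop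
    have m3 : ∀ i j, Measurable (fun x => ‖(u (x - ε • z) - u x) * g i j x‖ₑ) := fun i j => by
      have := hgm i j
      fun_prop
    have m4 : Measurable (fun x => ‖(u (x - ε • z) - u x) * dv x‖ₑ) := by fun_prop
    calc ∫⁻ x in Q, ‖I x z - u x * P x z‖ₑ
        ≤ ∫⁻ x in Q, (L * C * (∑ i, ‖W i x z‖ₑ + ‖dv (x - ε • z) - dv x‖ₑ)
          + C * (∑ i, ∑ j, ‖(u (x - ε • z) - u x) * g i j x‖ₑ
          + ‖(u (x - ε • z) - u x) * dv x‖ₑ)) := lintegral_mono fun x => hbound x z hz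
      _ = L * C * (∑ i, (∫⁻ x in Q, ‖W i x z‖ₑ) + ∫⁻ x in Q, ‖dv (x - ε • z) - dv x‖ₑ)
          + C * (∑ i, ∑ j, (∫⁻ x in Q, ‖(u (x - ε • z) - u x) * g i j x‖ₑ)
          + ∫⁻ x in Q, ‖(u (x - ε • z) - u x) * dv x‖ₑ) := by
        rw [lintegral_add_right _ (by fun_prop), lintegral_const_mul _ (by fun_prop),
          lintegral_const_mul _ (by fun_prop), lintegral_add_right _ m2,
          lintegral_add_right _ m4, lintegral_finsetSum _ (fun i _ => m1 i),
          lintegral_finsetSum _ (fun i _ => Finset.measurable_sum _ fun j _ => m3 i j)]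
        simp_rw [lintegral_finsetSum _ (fun j _ => m3 _ j)]
      _ ≤ L * C * (∑ i : Fin d, (c : ℝ≥0∞) + c)
          + C * (∑ i : Fin d, ∑ j : Fin d, (c : ℝ≥0∞) + c) := by
        refine add_le_add (mul_le_mul' le_rfl (add_le_add ?_ (E2 z hz')))
          (mul_le_mul' le_rfl (add_le_add ?_ (E4 z hz')))
        · exact Finset.sum_le_sum fun i _ => hWb i z hz
        · exact Finset.sum_le_sum fun i _ => Finset.sum_le_sum fun j _ => E3 z hz' i j
      _ = c * (L * C * (d + 1) + C * (d * d + 1)) := by simp; ring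
  have hjm : Measurable (Function.uncurry fun x z => ‖I x z - u x * P x z‖ₑ) := by
    have hs : Measurable (fun p : EuclideanSpace ℝ (Fin d) × EuclideanSpace ℝ (Fin d) =>
      p.1 - ε • p.2) := by fun_prop
    have a1 := hum.comp hs
    have a2 := fun i => (hbm i).comp hs
    have a3 := hdvm.comp hs
    have a4 := fun i => (hφ i).measurable
    have a5 := hθ.measurable
    simp only [hI, hP, Function.uncurry_def]
    simp only [Function.comp_def] at a1 a2 a3
    fun_prop
  calc ∫⁻ x in Q, ‖∫ z, I x z‖ₑ
      ≤ ∫⁻ x in Q, ∫⁻ z, ‖I x z - u x * P x z‖ₑ := by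
        refine lintegral_mono_ae ?_
        filter_upwards [ae_restrict_of_ae hPzero] with x hx
        have : ∫ z, I x z = ∫ z, (I x z - u x * P x z) := by
          rw [integral_sub (hIint x) ((hPint x).const_mul _), integral_const_mul, hx]; simp
        rw [this]
        exact enorm_integral_le_lintegral_enorm _
    _ = ∫⁻ z, ∫⁻ x in Q, ‖I x z - u x * P x z‖ₑ :=
        lintegral_lintegral_swap hjm.aemeasurable
    _ = ∫⁻ z in B, ∫⁻ x in Q, ‖I x z - u x * P x z‖ₑ := by
        refine (setLIntegral_eq_of_support_subset ?_).symm
        intro z hz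
        by_contra hzB
        exact hz (by simp [hzero _ z hzB])
    _ ≤ ∫⁻ z in B, c * (L * C * (d + 1) + C * (d * d + 1)) :=
        setLIntegral_mono' measurableSet_closedBall fun z hz => hslice z hz
    _ = c * A := by rw [setLIntegral_const, hA]; ring
    _ ≤ η := hc.le

end main

/-- DiPerna–Lions commutator lemma: for `u ∈ L^∞`,
`b ∈ W^{1,1}_loc` (with weak derivative `Db` and weak divergence `divb ∈ L^1_loc`),
and a smooth even nonnegative mollifier θ supported in the unit ball, the commutator
`r_ε = b·∇(u*θ_ε) − (b·∇u)*θ_ε` (the distributional product written out explicitly)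
tends to 0 in `L^1(Q)` for every compact `Q`, as `ε → 0⁺`. -/
theorem stmt_3 (d : ℕ)
    (u : EuclideanSpace ℝ (Fin d) → ℝ)
    (b : EuclideanSpace ℝ (Fin d) → EuclideanSpace ℝ (Fin d))
    (Db : EuclideanSpace ℝ (Fin d) → Fin d → Fin d → ℝ)
    (divb : EuclideanSpace ℝ (Fin d) → ℝ)
    (hu_meas : AEStronglyMeasurable u volume)
    (hu_bdd : ∃ L : ℝ, ∀ᵐ x ∂volume, |u x| ≤ L)
    (hb_loc : LocallyIntegrable b volume)
    (hDb_loc : LocallyIntegrable Db volume)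
    (hdivb_loc : LocallyIntegrable divb volume)
    -- Db is the weak (Sobolev) derivative of b:
    (hweak : ∀ ψ : EuclideanSpace ℝ (Fin d) → ℝ, ContDiff ℝ (⊤ : ℕ∞) ψ → HasCompactSupport ψ →
      ∀ i j : Fin d, ∫ x, Db x i j * ψ x =
        -∫ x, (b x i) * fderiv ℝ ψ x (EuclideanSpace.single j 1))
    -- divb is the weak divergence of b:
    (hdiv : ∀ ψ : EuclideanSpace ℝ (Fin d) → ℝ, ContDiff ℝ (⊤ : ℕ∞) ψ → HasCompactSupport ψ →
      ∫ x, divb x * ψ x = -∫ x, ⟪b x, gradient ψ x⟫)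
    (θ : EuclideanSpace ℝ (Fin d) → ℝ)
    (hθ_smooth : ContDiff ℝ (⊤ : ℕ∞) θ)
    (hθ_even : ∀ x, θ (-x) = θ x)
    (hθ_nonneg : ∀ x, 0 ≤ θ x)
    (hθ_supp : tsupport θ ⊆ closedBall 0 1)
    (hθ_int : ∫ x, θ x = 1)
    (r : ℝ → EuclideanSpace ℝ (Fin d) → ℝ)
    -- explicit form of the commutator  b·∇(u*θ_ε) − (b·∇u)*θ_ε :
    (hr : ∀ ε : ℝ, 0 < ε → ∀ x, r ε x =
      (∫ y, u y * ⟪b x - b y, (ε ^ (-(d:ℝ) - 1)) • gradient θ (ε⁻¹ • (x - y))⟫) +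
      ∫ y, u y * divb y * (ε ^ (-(d:ℝ)) * θ (ε⁻¹ • (x - y)))) :
    ∀ Q : Set (EuclideanSpace ℝ (Fin d)), IsCompact Q →
      Tendsto (fun ε => ∫ x in Q, |r ε x|) (𝓝[>] (0:ℝ)) (𝓝 0) := by
  intro Q hQ
  obtain ⟨L0, hL0⟩ := hu_bdd
  -- measurable representatives
  have hbA := hb_loc.aestronglyMeasurable
  have hDA := hDb_loc.aestronglyMeasurable
  have hdA := hdivb_loc.aestronglyMeasurable
  set L : NNReal := Real.toNNReal L0 with hLdef
  set u' : EuclideanSpace ℝ (Fin d) → ℝ := fun x => max (-(L:ℝ)) (min L (hu_meas.mk u x)) with hu'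
  set b' := hbA.mk b with hb'
  set D' := hDA.mk Db with hD'
  set v' := hdA.mk divb with hv'
  have hum : Measurable u' :=
    measurable_const.max (measurable_const.min hu_meas.stronglyMeasurable_mk.measurable)
  have hL : ∀ x, ‖u' x‖₊ ≤ L := by
    intro x
    rw [← NNReal.coe_le_coe, coe_nnnorm, Real.norm_eq_abs, abs_le]
    refine ⟨le_max_left _ _, max_le ?_ (min_le_left _ _)⟩
    have := L.2
    linarith [this, NNReal.coe_nonneg L]
  have huu : ∀ᵐ x, u x = u' x := by
    filter_upwards [hu_meas.ae_eq_mk, hL0] with x h1 h2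
    have h3 : |u x| ≤ L := h2.trans (Real.le_coe_toNNReal _)
    rw [abs_le] at h3
    simp only [hu', ← h1]
    rw [min_eq_right h3.2, max_eq_right h3.1]
  have hbb : ∀ᵐ x, b x = b' x := hbA.ae_eq_mk
  have hDD : ∀ᵐ x, Db x = D' x := hDA.ae_eq_mk
  have hvv : ∀ᵐ x, divb x = v' x := hdA.ae_eq_mk
  have hb'm : ∀ i, Measurable (fun x => b' x i) := fun i => by
    have := hbA.stronglyMeasurable_mk.measurable
    fun_prop
  have hD'm : ∀ i j, Measurable (fun x => D' x i j) := fun i j => by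
    have := hDA.stronglyMeasurable_mk.measurable
    exact measurable_pi_iff.1 (measurable_pi_iff.1 this i) j
  have hv'm : Measurable v' := hdA.stronglyMeasurable_mk.measurable
  have hb'l : ∀ i, LocallyIntegrable (fun x => b' x i) volume := fun i x => by
    obtain ⟨s, hs, hi⟩ := hb_loc x
    refine ⟨s, hs, ?_⟩
    have h1 : Integrable (fun x => b' x) (volume.restrict s) :=
      Integrable.congr hi (ae_restrict_of_ae hbb)
    exact (EuclideanSpace.proj i : EuclideanSpace ℝ (Fin d) →L[ℝ] ℝ).integrable_comp h1
  have hD'l : ∀ i j, LocallyIntegrable (fun x => D' x i j) volume := fun i j x => by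
    obtain ⟨s, hs, hi⟩ := hDb_loc x
    refine ⟨s, hs, ?_⟩
    have h1 : Integrable (fun x => D' x) (volume.restrict s) :=
      Integrable.congr hi (ae_restrict_of_ae hDD)
    exact (h1.eval i).eval j
  have hv'l : LocallyIntegrable v' volume := fun x => by
    obtain ⟨s, hs, hi⟩ := hdivb_loc x
    exact ⟨s, hs, Integrable.congr hi (ae_restrict_of_ae hvv)⟩
  have hw : ∀ ψ : EuclideanSpace ℝ (Fin d) → ℝ, ContDiff ℝ (⊤ : ℕ∞) ψ → HasCompactSupport ψ →
      ∀ i j, ∫ x, D' x i j * ψ x = -∫ x, b' x i * fderiv ℝ ψ x (EuclideanSpace.single j 1) := by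
    intro ψ h1 h2 i j
    have := hweak ψ h1 h2 i j
    rw [integral_congr_ae (g := fun x => Db x i j * ψ x)
      (by filter_upwards [hDD] with x hx; rw [hx]), this,
      integral_congr_ae (f := fun x => b x i * fderiv ℝ ψ x (EuclideanSpace.single j 1))
      (by filter_upwards [hbb] with x hx; rw [hx])]
  have hinner : ∀ (ψ : EuclideanSpace ℝ (Fin d) → ℝ) (x v : EuclideanSpace ℝ (Fin d)),
      ⟪v, gradient ψ x⟫ = ∑ i, v i * fderiv ℝ ψ x (EuclideanSpace.single i 1) := by
    intro ψ x v
    rw [real_inner_comm, gradient, InnerProductSpace.toDual_symm_apply, fderiv_sum_basis]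
  have htr : ∀ᵐ x, v' x = ∑ i, D' x i i := by
    refine ae_eq_of_integral_contDiff_smul_eq hv'l
      (locallyIntegrable_finsetSum _ fun i _ => hD'l i i) ?_
    intro ψ hψ hψc
    have hψ1 : ContDiff ℝ 1 ψ := hψ.of_le (by exact_mod_cast le_top)
    have i1 : ∀ i, Integrable (fun x => D' x i i * ψ x) volume := fun i => by
      simpa [mul_comm] using (hD'l i i).integrable_smul_left_of_hasCompactSupport hψ.continuous hψc
    have i2 : ∀ i, Integrable (fun x => b' x i * fderiv ℝ ψ x (EuclideanSpace.single i 1)) volume :=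
      fun i => by
      simpa [mul_comm] using (hb'l i).integrable_smul_left_of_hasCompactSupport
        ((hψ1.continuous_fderiv one_ne_zero).clm_apply continuous_const)
        (hψc.fderiv_apply (𝕜 := ℝ) (EuclideanSpace.single i 1))
    calc ∫ x, ψ x • v' x = ∫ x, divb x * ψ x := by
          refine integral_congr_ae ?_
          filter_upwards [hvv] with x hx
          rw [hx, smul_eq_mul, mul_comm]
      _ = -∫ x, ⟪b x, gradient ψ x⟫ := hdiv ψ hψ hψc
      _ = -∫ x, ∑ i, b' x i * fderiv ℝ ψ x (EuclideanSpace.single i 1) := by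
          congr 1
          refine integral_congr_ae ?_
          filter_upwards [hbb] with x hx
          rw [hinner, hx]
      _ = ∑ i, ∫ x, D' x i i * ψ x := by
          rw [integral_finsetSum _ fun i _ => i2 i, ← Finset.sum_neg_distrib]
          exact Finset.sum_congr rfl fun i _ => (hw ψ hψ hψc i i).symm
      _ = ∫ x, ψ x • ∑ i, D' x i i := by
          rw [← integral_finsetSum _ fun i _ => i1 i]
          congr 1; ext x
          rw [smul_eq_mul, mul_comm, Finset.sum_mul]
  have hθ1 : ContDiff ℝ 1 θ := hθ_smooth.of_le (by exact_mod_cast le_top)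
  have hθc : HasCompactSupport θ :=
    (isCompact_closedBall _ _).of_isClosed_subset (isClosed_tsupport _) hθ_supp
  have hmain := main_aux (b := fun i x => b' x i) (g := fun i j x => D' x i j) hum hL hb'l hb'm
    hD'l hD'm hv'l hv'm hw htr (θ := θ)
    (φ := fun i z => fderiv ℝ θ z (EuclideanSpace.single i 1)) hθ1.continuous hθ_supp hθ_int
    (fun i => (hθ1.continuous_fderiv one_ne_zero).clm_apply continuous_const)
    (fun i => (tsupport_fderiv_apply_subset ℝ (EuclideanSpace.single i (1:ℝ))).trans hθ_supp)
    (fun i j => theta_moment hθ1 hθc hθ_int i j) hQ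
  -- change of variables
  have hcv : ∀ ε : ℝ, 0 < ε → ∀ᵐ x, r ε x = ∫ z, u' (x - ε • z) *
      (∑ i, ε⁻¹ * (b' x i - b' (x - ε • z) i) * fderiv ℝ θ z (EuclideanSpace.single i 1)
        + v' (x - ε • z) * θ z) := by
    intro ε hε
    filter_upwards [hbb] with x hx
    have cov : ∀ F : EuclideanSpace ℝ (Fin d) → ℝ, ∫ y, F y = ε ^ d * ∫ z, F (x - ε • z) := by
      intro F
      have h1 := Measure.integral_comp_smul volume (fun w => F (x - w)) ε
      rw [integral_sub_left_eq_self F volume x, finrank_euclideanSpace_fin, smul_eq_mul,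
        abs_of_pos (by positivity)] at h1
      rw [h1, mul_inv_cancel_left₀ (by positivity)]
    have hr1 : ε ^ d * ε ^ (-(d:ℝ)) = 1 := by
      rw [Real.rpow_neg hε.le, Real.rpow_natCast, mul_inv_cancel₀ (by positivity)]
    have hr2 : ε ^ d * ε ^ (-(d:ℝ) - 1) = ε⁻¹ := by
      rw [Real.rpow_sub hε, Real.rpow_one, ← mul_div_assoc, hr1, one_div]
    have hs : ∀ z : EuclideanSpace ℝ (Fin d), ε⁻¹ • (x - (x - ε • z)) = z := fun z => by
      simp [smul_smul, hε.ne']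
    have T1 : ∫ y, u y * ⟪b x - b y, (ε ^ (-(d:ℝ) - 1)) • gradient θ (ε⁻¹ • (x - y))⟫
        = ∫ z, u' (x - ε • z) *
      (∑ i, ε⁻¹ * (b' x i - b' (x - ε • z) i) * fderiv ℝ θ z (EuclideanSpace.single i 1)) := by
      rw [integral_congr_ae (g := fun y => u' y *
        ⟪b' x - b' y, (ε ^ (-(d:ℝ) - 1)) • gradient θ (ε⁻¹ • (x - y))⟫)
        (by filter_upwards [huu, hbb] with y h1 h2; rw [h1, h2, hx]), cov, ← integral_const_mul]
      congr 1; ext z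
      rw [hs, inner_smul_right, hinner, ← hr2, Finset.mul_sum, Finset.mul_sum, Finset.mul_sum,
        Finset.mul_sum]
      refine Finset.sum_congr rfl fun i _ => ?_
      simp only [PiLp.sub_apply]
      ring
    have T2 : ∫ y, u y * divb y * (ε ^ (-(d:ℝ)) * θ (ε⁻¹ • (x - y)))
        = ∫ z, u' (x - ε • z) * (v' (x - ε • z) * θ z) := by
      rw [integral_congr_ae (g := fun y => u' y * v' y * (ε ^ (-(d:ℝ)) * θ (ε⁻¹ • (x - y))))
        (by filter_upwards [huu, hvv] with y h1 h2; rw [h1, h2]), cov, ← integral_const_mul]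
      congr 1; ext z
      rw [hs]
      linear_combination (u' (x - ε • z) * v' (x - ε • z) * θ z) * hr1
    have hφcont : ∀ i : Fin d, Continuous fun z => fderiv ℝ θ z (EuclideanSpace.single i 1) :=
      fun i => (hθ1.continuous_fderiv one_ne_zero).clm_apply continuous_const
    have hφc : ∀ i : Fin d, HasCompactSupport fun z => fderiv ℝ θ z (EuclideanSpace.single i 1) :=
      fun i => hθc.fderiv_apply (𝕜 := ℝ) _
    have k1 := fun i => int_I (f := fun _ => (1:ℝ)) (locallyIntegrable_const _) hum hL
      (hφcont i) (hφc i) x hε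
    have k2 := fun i => int_I (hb'l i) hum hL (hφcont i) (hφc i) x hε
    have k3 := int_I hv'l hum hL hθ1.continuous hθc x hε
    have k4 : Integrable (fun z => u' (x - ε • z) * (∑ i, ε⁻¹ * (b' x i - b' (x - ε • z) i) *
        fderiv ℝ θ z (EuclideanSpace.single i 1))) volume := by
      refine (integrable_finsetSum Finset.univ fun i _ =>
        (((k1 i).const_mul (b' x i)).sub (k2 i)).const_mul ε⁻¹).congr (ae_of_all _ fun z => ?_)
      simp only [Pi.sub_apply]
      rw [Finset.mul_sum]
      exact Finset.sum_congr rfl fun i _ => by ring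
    rw [hr ε hε x, T1, T2, ← integral_add k4 k3]
    congr 1; ext z; ring
  -- conclusion
  rw [Metric.tendsto_nhds]
  intro e he
  have he2 : ENNReal.ofReal (e / 2) ≠ 0 := by
    simpa using he
  filter_upwards [hmain _ he2, self_mem_nhdsWithin] with ε h1 hε
  rw [dist_zero_right]
  have h2 : ‖∫ x in Q, |r ε x|‖ₑ ≤ ENNReal.ofReal (e / 2) := by
    refine (enorm_integral_le_lintegral_enorm _).trans (le_trans (le_of_eq ?_) h1)
    refine lintegral_congr_ae ?_
    filter_upwards [ae_restrict_of_ae (hcv ε hε)] with x hx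
    rw [← hx, ← Real.norm_eq_abs, enorm_norm]
  rw [← ofReal_norm, ENNReal.ofReal_le_ofReal_iff (by positivity)] at h2
  linarith
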